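/- Let f : Ω_κ → [0, ∞) be a nonnegative function such that (1) Γ⁺(f)² ≤ f pointwise and (2) |f(ω) − f(τ_ij ω)| ≤ 1 for all ω ∈ Ω_κ and all 1 ≤ i < j ≤ N. Then for every t ∈ [0, E_κ f], P_κ(E_κ f − f ≥ t) ≤ exp(− t² / (32 E_κ f)); in particular, P_κ(f = 0) · exp(E_κ f / 32) ≤ 1. Moreover, the function f(ω) = (1/4) d_T(ω, A)² satisfies hypotheses (1) and (2) for every subset A ⊆ Ω_κ. -/

import Mathlib

open Finset Real
open scoped Classical

noncomputable section

/-- The multislice `Ω_κ ⊆ 𝒳^N`: vectors with values in `{x ℓ}` where the value `x ℓ`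
appears exactly `κ ℓ` times. -/
def multislice (L N : ℕ) (κ : Fin L → ℕ) (x : Fin L → ℝ) : Finset (Fin N → ℝ) :=
  (Fintype.piFinset fun _ : Fin N => Finset.image x Finset.univ).filter
    (fun ω => ∀ ℓ : Fin L, (Finset.univ.filter fun i => ω i = x ℓ).card = κ ℓ)

/-- Expectation with respect to the uniform distribution on a finite set. -/
def uexpect {α : Type*} (Ω : Finset α) (f : α → ℝ) : ℝ := (∑ ω ∈ Ω, f ω) / Ω.card

/-- Probability of an event with respect to the uniform distribution on a finite set. -/
def uprob {α : Type*} (Ω : Finset α) (p : α → Prop) : ℝ :=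
  ((Ω.filter p).card : ℝ) / Ω.card

/-- Talagrand's convex distance `d_T(ω, A)` between a point `ω` and a set `A`. -/
def convexDist {m : ℕ} (ω : Fin m → ℝ) (A : Set (Fin m → ℝ)) : ℝ :=
  sSup { r : ℝ | ∃ α : Fin m → ℝ, (∑ i, α i ^ 2) = 1 ∧
    r = sInf { s : ℝ | ∃ ω' ∈ A, s = ∑ i, |α i| * (if ω i = ω' i then (0 : ℝ) else 1) } }

/-- The entropy functional `Ent_μ(g) = E_μ[g log g] − (E_μ g) log (E_μ g)` with respect to
the uniform distribution on a finite set. -/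
def uent {α : Type*} (Ω : Finset α) (g : α → ℝ) : ℝ :=
  uexpect Ω (fun ω => g ω * Real.log (g ω)) - uexpect Ω g * Real.log (uexpect Ω g)

/-- `Γ(f)² (ω) = (1/(2N)) ∑_{i<j} (f(ω) − f(τ_ij ω))²`. -/
def gammaSq {N : ℕ} (f : (Fin N → ℝ) → ℝ) (ω : Fin N → ℝ) : ℝ :=
  (1 / (2 * (N : ℝ))) * ∑ q ∈ (Finset.univ : Finset (Fin N × Fin N)).filter
    (fun q => q.1 < q.2), (f ω - f (ω ∘ Equiv.swap q.1 q.2)) ^ 2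

/-- `Γ⁺(f)² (ω) = (1/(2N)) ∑_{i<j} ((f(ω) − f(τ_ij ω))₊)²`. -/
def gammaPlusSq {N : ℕ} (f : (Fin N → ℝ) → ℝ) (ω : Fin N → ℝ) : ℝ :=
  (1 / (2 * (N : ℝ))) * ∑ q ∈ (Finset.univ : Finset (Fin N × Fin N)).filter
    (fun q => q.1 < q.2), (max (f ω - f (ω ∘ Equiv.swap q.1 q.2)) 0) ^ 2


section ModifiedLogSobolev

variable {α : Type*} [Fintype α] [DecidableEq α]

/-- The permutations that fix every point outside `S`. -/
def permsOn (S : Finset α) : Finset (Equiv.Perm α) :=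
  Finset.univ.filter fun ρ => ∀ i, i ∉ S → ρ i = i

/-- The average of `h` over the coset `σ * permsOn S`. -/
def cosetAvg (S : Finset α) (h : Equiv.Perm α → ℝ) (σ : Equiv.Perm α) : ℝ :=
  (∑ ρ ∈ permsOn S, h (σ * ρ)) / (permsOn S).card

/-- The symmetrized relative entropy density `(a - b) (log a - log b)`. -/
def logCross (a b : ℝ) : ℝ := (a - b) * (Real.log a - Real.log b)

lemma logCross_self (a : ℝ) : logCross a a = 0 := by simp [logCross]

lemma logCross_nonneg {a b : ℝ} (ha : 0 < a) (hb : 0 < b) : 0 ≤ logCross a b := by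
  unfold logCross
  rcases le_total a b with hab | hab
  · have := Real.log_le_log ha hab
    exact mul_nonneg_of_nonpos_of_nonpos (by linarith) (by linarith)
  · have := Real.log_le_log hb hab
    exact mul_nonneg (by linarith) (by linarith)

lemma mul_log_le_tangent {x y : ℝ} (hx : 0 < x) (hy : 0 < y) :
    x * Real.log y ≤ x * Real.log x + y - x := by
  have h := Real.log_le_sub_one_of_pos (div_pos hy hx)
  rw [Real.log_div hy.ne' hx.ne'] at h
  have h2 := mul_le_mul_of_nonneg_left h hx.le
  have h3 : x * (y / x - 1) = y - x := by field_simp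
  nlinarith

lemma log_sum_inequality {ι : Type*} (P : Finset ι) (x y : ι → ℝ) {X Y : ℝ}
    (hx : ∀ i ∈ P, 0 < x i) (hy : ∀ i ∈ P, 0 < y i) (hX : 0 < X) (hY : 0 < Y)
    (hxX : ∑ i ∈ P, x i = P.card * X) (hyY : ∑ i ∈ P, y i = P.card * Y) :
    P.card * (X * (Real.log X - Real.log Y)) ≤
      ∑ i ∈ P, x i * (Real.log (x i) - Real.log (y i)) := by
  have h : ∀ i ∈ P, x i * (Real.log X - Real.log Y) + x i - y i * (X / Y) ≤
      x i * (Real.log (x i) - Real.log (y i)) := by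
    intro i hi
    have hz : 0 < y i * (X / Y) := mul_pos (hy i hi) (div_pos hX hY)
    have := mul_log_le_tangent (hx i hi) hz
    rw [Real.log_mul (hy i hi).ne' (div_pos hX hY).ne', Real.log_div hX.ne' hY.ne'] at this
    linarith
  refine le_trans (le_of_eq ?_) (Finset.sum_le_sum h)
  rw [Finset.sum_sub_distrib, Finset.sum_add_distrib, ← Finset.sum_mul, ← Finset.sum_mul,
    hxX, hyY]
  field_simp
  ring

lemma logCross_avg_le {ι : Type*} (P : Finset ι) (hP : P.Nonempty) (x y : ι → ℝ)
    (hx : ∀ i, 0 < x i) (hy : ∀ i, 0 < y i) :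
    logCross ((∑ i ∈ P, x i) / P.card) ((∑ i ∈ P, y i) / P.card) ≤
      (∑ i ∈ P, logCross (x i) (y i)) / P.card := by
  have hn : (0 : ℝ) < P.card := by exact_mod_cast hP.card_pos
  have hX : 0 < (∑ i ∈ P, x i) / P.card := div_pos (Finset.sum_pos (fun i _ => hx i) hP) hn
  have hY : 0 < (∑ i ∈ P, y i) / P.card := div_pos (Finset.sum_pos (fun i _ => hy i) hP) hn
  have h1 := log_sum_inequality P x y (fun i _ => hx i) (fun i _ => hy i) hX hY
    (by field_simp) (by field_simp)
  have h2 := log_sum_inequality P y x (fun i _ => hy i) (fun i _ => hx i) hY hX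
    (by field_simp) (by field_simp)
  rw [le_div_iff₀ hn]
  have h3 : ∑ i ∈ P, logCross (x i) (y i) =
      ∑ i ∈ P, x i * (Real.log (x i) - Real.log (y i)) +
      ∑ i ∈ P, y i * (Real.log (y i) - Real.log (x i)) := by
    rw [← Finset.sum_add_distrib]
    exact Finset.sum_congr rfl fun i _ => by unfold logCross; ring
  rw [h3]
  unfold logCross
  linarith

lemma one_mem_permsOn (S : Finset α) : 1 ∈ permsOn S := by simp [permsOn]

lemma card_permsOn_pos (S : Finset α) : (0 : ℝ) < (permsOn S).card := by
  exact_mod_cast Finset.card_pos.2 ⟨1, one_mem_permsOn S⟩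

lemma permsOn_empty : permsOn (∅ : Finset α) = {1} := by
  ext ρ
  simp [permsOn, Equiv.ext_iff]

lemma permsOn_univ : permsOn (Finset.univ : Finset α) = Finset.univ := by
  simp [permsOn]

lemma sum_permsOn_erase (S : Finset α) {k : α} (hk : k ∈ S) (g : Equiv.Perm α → ℝ) :
    ∑ ρ ∈ permsOn S, g ρ =
      ∑ j ∈ S, ∑ ρ ∈ permsOn (S.erase k), g (Equiv.swap k j * ρ) := by
  rw [← Finset.sum_product']
  symm
  refine Finset.sum_nbij' (fun p => Equiv.swap k p.1 * p.2)
    (fun ρ => (ρ k, Equiv.swap k (ρ k) * ρ)) ?_ ?_ ?_ ?_ ?_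
  · rintro ⟨j, ρ⟩ h
    simp only [permsOn, Finset.mem_product, Finset.mem_filter, Finset.mem_univ, true_and] at h ⊢
    intro i hi
    rw [Equiv.Perm.mul_apply, h.2 i (fun h' => hi (Finset.mem_of_mem_erase h'))]
    exact Equiv.swap_apply_of_ne_of_ne (fun e => hi (e ▸ hk)) (fun e => hi (e ▸ h.1))
  · intro ρ h
    simp only [permsOn, Finset.mem_product, Finset.mem_filter, Finset.mem_univ, true_and] at h ⊢
    have hS : ρ k ∈ S := by
      by_contra hc
      exact hc (by rw [ρ.injective (h _ hc)]; exact hk)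
    refine ⟨hS, fun i hi => ?_⟩
    by_cases hik : i = k
    · subst hik; simp
    · have hiS : i ∉ S := fun h' => hi (Finset.mem_erase.2 ⟨hik, h'⟩)
      rw [Equiv.Perm.mul_apply, h i hiS]
      exact Equiv.swap_apply_of_ne_of_ne hik (fun e => hiS (e ▸ hS))
  · rintro ⟨j, ρ⟩ h
    simp only [permsOn, Finset.mem_product, Finset.mem_filter, Finset.mem_univ, true_and] at h
    have hρ : ρ k = k := h.2 k (by simp)
    simp [hρ, ← mul_assoc]
  · intro ρ _
    simp [← mul_assoc]
  · intro p _
    rfl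

lemma card_permsOn_erase (S : Finset α) {k : α} (hk : k ∈ S) :
    ((permsOn S).card : ℝ) = S.card * (permsOn (S.erase k)).card := by
  simpa using sum_permsOn_erase S hk (fun _ => 1)

lemma cosetAvg_eq_avg_erase (S : Finset α) {k : α} (hk : k ∈ S) (h : Equiv.Perm α → ℝ)
    (σ : Equiv.Perm α) :
    cosetAvg S h σ =
      (∑ j ∈ S, cosetAvg (S.erase k) h (σ * Equiv.swap k j)) / S.card := by
  unfold cosetAvg
  rw [sum_permsOn_erase S hk (fun ρ => h (σ * ρ)), card_permsOn_erase S hk,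
    ← Finset.sum_div, div_div, mul_comm (S.card : ℝ)]
  simp only [mul_assoc]

lemma cosetAvg_pos (S : Finset α) {h : Equiv.Perm α → ℝ} (hh : ∀ σ, 0 < h σ)
    (σ : Equiv.Perm α) : 0 < cosetAvg S h σ :=
  div_pos (Finset.sum_pos (fun _ _ => hh _) ⟨1, one_mem_permsOn S⟩) (card_permsOn_pos S)

lemma sum_comp_mul_right (g : Equiv.Perm α → ℝ) (ρ : Equiv.Perm α) :
    ∑ σ, g (σ * ρ) = ∑ σ, g σ :=
  Equiv.sum_comp (Equiv.mulRight ρ) g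

lemma sum_cosetAvg (S : Finset α) (h : Equiv.Perm α → ℝ) :
    ∑ σ, cosetAvg S h σ = ∑ σ, h σ := by
  unfold cosetAvg
  rw [← Finset.sum_div, Finset.sum_comm]
  simp only [sum_comp_mul_right h, Finset.sum_const, nsmul_eq_mul]
  have := card_permsOn_pos S
  field_simp

lemma sum_sub_mul_log_swap (φ : Equiv.Perm α → ℝ) (i j : α) :
    ∑ σ, (φ σ - φ (σ * Equiv.swap i j)) * Real.log (φ σ) =
      (∑ σ, logCross (φ σ) (φ (σ * Equiv.swap i j))) / 2 := by
  have h := sum_comp_mul_right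
    (fun σ => (φ σ - φ (σ * Equiv.swap i j)) * Real.log (φ σ)) (Equiv.swap i j)
  simp only [mul_assoc, Equiv.swap_mul_self, mul_one] at h
  rw [eq_div_iff two_ne_zero, mul_two]
  nth_rw 1 [← h]
  rw [← Finset.sum_add_distrib]
  exact Finset.sum_congr rfl fun σ _ => by unfold logCross; ring

lemma sum_logCross_cosetAvg_le (S : Finset α) {k : α} {h : Equiv.Perm α → ℝ}
    (hh : ∀ σ, 0 < h σ) :
    ∑ σ, ∑ j ∈ S, logCross (cosetAvg (S.erase k) h σ)
        (cosetAvg (S.erase k) h (σ * Equiv.swap k j)) ≤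
      ∑ σ, ∑ j ∈ S, logCross (h σ) (h (σ * Equiv.swap k j)) := by
  rw [← sum_cosetAvg (S.erase k) (fun σ => ∑ j ∈ S, logCross (h σ) (h (σ * Equiv.swap k j)))]
  refine Finset.sum_le_sum fun σ _ => ?_
  have hn := card_permsOn_pos (S.erase k)
  refine (Finset.sum_le_sum fun j _ => logCross_avg_le (permsOn (S.erase k))
    ⟨1, one_mem_permsOn _⟩ (fun ρ => h (σ * ρ)) (fun ρ => h (σ * Equiv.swap k j * ρ))
    (fun _ => hh _) (fun _ => hh _)).trans (le_of_eq ?_)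
  unfold cosetAvg
  rw [← Finset.sum_div, Finset.sum_comm]
  congr 1
  refine Finset.sum_congr rfl fun ρ hρ => ?_
  simp only [permsOn, Finset.mem_filter, Finset.mem_univ, true_and] at hρ
  have hk : ρ⁻¹ k = k := by
    rw [Equiv.Perm.inv_eq_iff_eq]; exact (hρ k (by simp)).symm
  have hS : {a | ρ⁻¹ a ≠ a} ⊆ (S : Set α) := by
    intro a ha
    by_contra hc
    refine ha ?_
    rw [Equiv.Perm.inv_eq_iff_eq]
    exact (hρ a (fun h' => hc (Finset.mem_of_mem_erase h'))).symm
  refine Eq.trans ?_ (Equiv.Perm.sum_comp ρ⁻¹ S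
    (fun j => logCross (h (σ * ρ)) (h (σ * ρ * Equiv.swap k j))) hS)
  refine Finset.sum_congr rfl fun j _ => ?_
  rw [mul_assoc σ, Equiv.swap_mul_eq_mul_swap, hk, mul_assoc σ]

lemma entropy_step_le (S : Finset α) {k : α} (hk : k ∈ S) {h : Equiv.Perm α → ℝ}
    (hh : ∀ σ, 0 < h σ) :
    ∑ σ, cosetAvg (S.erase k) h σ * Real.log (cosetAvg (S.erase k) h σ) -
        ∑ σ, cosetAvg S h σ * Real.log (cosetAvg S h σ) ≤
      (∑ j ∈ S, ∑ σ, logCross (h σ) (h (σ * Equiv.swap k j))) / (2 * S.card) := by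
  have hs : (0 : ℝ) < S.card := by exact_mod_cast Finset.card_pos.2 ⟨k, hk⟩
  set φ := cosetAvg (S.erase k) h with hφ
  have h1 : ∑ σ, cosetAvg S h σ * Real.log (φ σ) ≤
      ∑ σ, cosetAvg S h σ * Real.log (cosetAvg S h σ) := by
    have := Finset.sum_le_sum fun σ (_ : σ ∈ (Finset.univ : Finset (Equiv.Perm α))) =>
      mul_log_le_tangent (cosetAvg_pos S hh σ) (cosetAvg_pos (S.erase k) hh σ)
    rw [Finset.sum_sub_distrib, Finset.sum_add_distrib, sum_cosetAvg, sum_cosetAvg] at this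
    linarith
  have h2 : ∑ σ, φ σ * Real.log (φ σ) - ∑ σ, cosetAvg S h σ * Real.log (φ σ) =
      (∑ σ, ∑ j ∈ S, logCross (φ σ) (φ (σ * Equiv.swap k j))) / (2 * S.card) := by
    rw [Finset.sum_comm, ← div_div, Finset.sum_div]
    simp only [← sum_sub_mul_log_swap]
    rw [Finset.sum_comm, Finset.sum_div, ← Finset.sum_sub_distrib]
    refine Finset.sum_congr rfl fun σ _ => ?_
    rw [cosetAvg_eq_avg_erase S hk, ← Finset.sum_mul, Finset.sum_sub_distrib, Finset.sum_const,
      nsmul_eq_mul, ← hφ]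
    field_simp
  have h3 := sum_logCross_cosetAvg_le S (k := k) hh
  rw [Finset.sum_comm (s := S)]
  calc _ ≤ _ := sub_le_sub_left h1 _
    _ = _ := h2
    _ ≤ _ := div_le_div_of_nonneg_right h3 (by positivity)

lemma sum_sum_erase {β : Type*} [DecidableEq β] (S : Finset β) (D : β → β → ℝ) (hD : ∀ i, D i i = 0) :
    ∑ k ∈ S, ∑ i ∈ S.erase k, ∑ j ∈ S.erase k, D i j =
      (S.card - 2) * ∑ i ∈ S, ∑ j ∈ S, D i j := by
  have h : ∀ k ∈ S, ∑ i ∈ S.erase k, ∑ j ∈ S.erase k, D i j =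
      ∑ i ∈ S, ∑ j ∈ S, D i j - ∑ j ∈ S, D k j - ∑ i ∈ S, D i k := by
    intro k hk
    have h' : ∀ i, ∑ j ∈ S.erase k, D i j = ∑ j ∈ S, D i j - D i k := fun i => by
      rw [← Finset.sum_erase_add S _ hk]; ring
    simp only [h', Finset.sum_sub_distrib]
    rw [← Finset.sum_erase_add S (fun i => ∑ j ∈ S, D i j) hk,
      ← Finset.sum_erase_add S (fun i => D i k) hk, hD k]
    ring
  rw [Finset.sum_congr rfl h, Finset.sum_sub_distrib, Finset.sum_sub_distrib, Finset.sum_const,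
    nsmul_eq_mul, Finset.sum_comm (f := fun k i => D i k)]
  ring

/-- Modified logarithmic Sobolev inequality for random transpositions of the points of `S`. -/
lemma modified_log_sobolev_permsOn (S : Finset α) {h : Equiv.Perm α → ℝ} (hh : ∀ σ, 0 < h σ) :
    ∑ σ, h σ * Real.log (h σ) - ∑ σ, cosetAvg S h σ * Real.log (cosetAvg S h σ) ≤
      (∑ i ∈ S, ∑ j ∈ S, ∑ σ, logCross (h σ) (h (σ * Equiv.swap i j))) / (2 * S.card) := by
  induction S using Finset.strongInduction with
  | H S ih =>
    rcases S.eq_empty_or_nonempty with rfl | hS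
    · simp [cosetAvg, permsOn_empty]
    set D : α → α → ℝ := fun i j => ∑ σ, logCross (h σ) (h (σ * Equiv.swap i j)) with hDdef
    have hD0 : ∀ i, D i i = 0 := fun i => by
      simp only [hDdef, Equiv.swap_self]
      exact Finset.sum_eq_zero fun σ _ => logCross_self _
    have hDnn : ∀ i j, 0 ≤ D i j := fun i j =>
      Finset.sum_nonneg fun σ _ => logCross_nonneg (hh _) (hh _)
    have hstep : ∀ k ∈ S,
        ∑ σ, h σ * Real.log (h σ) - ∑ σ, cosetAvg S h σ * Real.log (cosetAvg S h σ) ≤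
        (∑ i ∈ S.erase k, ∑ j ∈ S.erase k, D i j) / (2 * (S.card - 1)) +
          (∑ j ∈ S, D k j) / (2 * S.card) := by
      intro k hk
      have h1 := ih (S.erase k) (Finset.erase_ssubset hk)
      have h2 := entropy_step_le S hk hh
      rw [Finset.cast_card_erase_of_mem hk] at h1
      linarith
    have hsum := Finset.sum_le_sum hstep
    rw [Finset.sum_const, nsmul_eq_mul, Finset.sum_add_distrib, ← Finset.sum_div,
      ← Finset.sum_div, sum_sum_erase S D hD0] at hsum
    have hT : 0 ≤ ∑ i ∈ S, ∑ j ∈ S, D i j :=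
      Finset.sum_nonneg fun i _ => Finset.sum_nonneg fun j _ => hDnn i j
    set T := ∑ i ∈ S, ∑ j ∈ S, D i j with hTdef
    have hs1 : (1 : ℝ) ≤ S.card := by exact_mod_cast hS.card_pos
    have hcoef : (S.card - 2) * T / (2 * (S.card - 1)) + T / (2 * S.card) ≤ T / 2 := by
      rcases hs1.eq_or_lt with he | hlt
      · rw [← he]; norm_num
      · have hpos : (0 : ℝ) < S.card - 1 := by linarith
        have hpos' : (0 : ℝ) < S.card := by linarith
        rw [div_add_div _ _ (by positivity) (by positivity), div_le_div_iff₀ (by positivity)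
          (by norm_num)]
        nlinarith
    rw [le_div_iff₀ (by linarith)]
    linarith

lemma modified_log_sobolev_perm {h : Equiv.Perm α → ℝ} (hh : ∀ σ, 0 < h σ) :
    ∑ σ, h σ * Real.log (h σ) -
        (∑ σ, h σ) * Real.log ((∑ σ, h σ) / Fintype.card (Equiv.Perm α)) ≤
      (∑ i, ∑ j, ∑ σ, logCross (h σ) (h (σ * Equiv.swap i j))) / (2 * Fintype.card α) := by
  have hm := modified_log_sobolev_permsOn Finset.univ hh
  have havg : ∀ σ, cosetAvg Finset.univ h σ = (∑ σ, h σ) / Fintype.card (Equiv.Perm α) :=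
    fun σ => by
      unfold cosetAvg
      rw [permsOn_univ, Finset.card_univ]
      congr 1
      exact Equiv.sum_comp (Equiv.mulLeft σ) h
  simp only [havg, Finset.sum_const, nsmul_eq_mul, Finset.card_univ] at hm
  have hn : (0 : ℝ) < Fintype.card (Equiv.Perm α) := by exact_mod_cast Fintype.card_pos
  rwa [← mul_assoc, mul_div_cancel₀ _ hn.ne'] at hm

end ModifiedLogSobolev

section LowerTail

lemma herbst_lower_bound {h h' : ℝ → ℝ} (hd : ∀ s, HasDerivAt h (h' s) s) (h0 : h 0 = 0)
    (hle : ∀ s, 0 < s → s ≤ 1 → h s ≤ s * (1 + 8 * s) * h' s) {s : ℝ} (hs : 0 < s)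
    (hs1 : s ≤ 1) : s * h' 0 ≤ (1 + 8 * s) * h s := by
  have hderiv : ∀ r, 0 < r → HasDerivAt (fun r => h r * (r⁻¹ + 8))
      (h' r * (r⁻¹ + 8) + h r * (-(r ^ 2)⁻¹)) r := fun r hr =>
    (hd r).mul ((hasDerivAt_inv hr.ne').add_const 8)
  have hmono : MonotoneOn (fun r => h r * (r⁻¹ + 8)) (Set.Ioc 0 1) := by
    refine monotoneOn_of_deriv_nonneg (convex_Ioc 0 1)
      (fun r hr => (hderiv r hr.1).continuousAt.continuousWithinAt)
      (fun r hr => ?_) (fun r hr => ?_)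
    · rw [interior_Ioc] at hr
      exact (hderiv r hr.1).differentiableAt.differentiableWithinAt
    · rw [interior_Ioc] at hr
      have hr0 : 0 < r := hr.1
      rw [(hderiv r hr0).deriv]
      have h1 := hle r hr0 hr.2.le
      have h2 : h' r * (r⁻¹ + 8) + h r * (-(r ^ 2)⁻¹) =
          (r * (1 + 8 * r) * h' r - h r) / r ^ 2 := by
        field_simp
        ring
      rw [h2]
      exact div_nonneg (by linarith) (by positivity)
  have hlim : Filter.Tendsto (fun r => h r * (r⁻¹ + 8)) (nhdsWithin 0 (Set.Ioi 0))
      (nhds (h' 0)) := by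
    have h1 : Filter.Tendsto (fun r => r⁻¹ * h r) (nhdsWithin 0 (Set.Ioi 0)) (nhds (h' 0)) := by
      have := (hasDerivAt_iff_tendsto_slope_zero.1 (hd 0)).mono_left
        (nhdsWithin_mono 0 (fun r (hr : r ∈ Set.Ioi (0 : ℝ)) => ne_of_gt hr))
      simpa [h0] using this
    have h2 : Filter.Tendsto (fun r => h r * 8) (nhdsWithin 0 (Set.Ioi 0)) (nhds 0) := by
      have := ((hd 0).continuousAt.tendsto.mul_const 8).mono_left
        (nhdsWithin_le_nhds (s := Set.Ioi (0 : ℝ)))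
      simpa [h0] using this
    have := h1.add h2
    rw [add_zero] at this
    exact this.congr fun r => by ring
  have hfin : h' 0 ≤ h s * (s⁻¹ + 8) := by
    refine le_of_tendsto hlim ?_
    filter_upwards [Ioc_mem_nhdsGT hs] with r hr
    exact hmono ⟨hr.1, hr.2.trans hs1⟩ ⟨hs, hs1⟩ hr.2
  calc s * h' 0 ≤ s * (h s * (s⁻¹ + 8)) := mul_le_mul_of_nonneg_left hfin hs.le
    _ = _ := by field_simp

lemma logCross_exp_le_of_le {a b s : ℝ} (hs : 0 < s) (hs1 : s ≤ 1) (hba : b ≤ a)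
    (hab : a - b ≤ 1) :
    logCross (Real.exp (-s * a)) (Real.exp (-s * b)) ≤
      2 * s ^ 2 * ((a - b) ^ 2 * Real.exp (-s * a)) := by
  have hx0 : 0 ≤ s * (a - b) := mul_nonneg hs.le (by linarith)
  have hx1 : s * (a - b) ≤ 1 := by nlinarith
  have he := Real.abs_exp_sub_one_le (x := s * (a - b)) (by rwa [abs_of_nonneg hx0])
  rw [abs_of_nonneg hx0] at he
  have he' := (le_abs_self _).trans he
  have hb : Real.exp (-s * b) = Real.exp (-s * a) * Real.exp (s * (a - b)) := by
    rw [← Real.exp_add]; ring_nf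
  unfold logCross
  rw [Real.log_exp, Real.log_exp, hb]
  have := mul_le_mul_of_nonneg_left he' (mul_nonneg hx0 (Real.exp_pos (-s * a)).le)
  linarith

lemma logCross_exp_le {a b s : ℝ} (hs : 0 < s) (hs1 : s ≤ 1) (hab : |a - b| ≤ 1) :
    logCross (Real.exp (-s * a)) (Real.exp (-s * b)) ≤
      2 * s ^ 2 * (max (a - b) 0 ^ 2 * Real.exp (-s * a)) +
      2 * s ^ 2 * (max (b - a) 0 ^ 2 * Real.exp (-s * b)) := by
  rw [abs_le] at hab
  rcases le_total b a with h | h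
  · rw [max_eq_left (by linarith : 0 ≤ a - b), max_eq_right (by linarith : b - a ≤ 0)]
    have := logCross_exp_le_of_le hs hs1 h hab.2
    linarith
  · rw [max_eq_right (by linarith : a - b ≤ 0), max_eq_left (by linarith : 0 ≤ b - a)]
    have := logCross_exp_le_of_le hs hs1 h (by linarith : b - a ≤ 1)
    have hc : logCross (Real.exp (-s * a)) (Real.exp (-s * b)) =
        logCross (Real.exp (-s * b)) (Real.exp (-s * a)) := by unfold logCross; ring
    linarith

variable {α : Type*} [Fintype α] [DecidableEq α]

lemma sum_logCross_exp_le {F : Equiv.Perm α → ℝ} {s : ℝ} (hs : 0 < s) (hs1 : s ≤ 1) (i j : α)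
    (hF : ∀ σ, |F σ - F (σ * Equiv.swap i j)| ≤ 1) :
    ∑ σ, logCross (Real.exp (-s * F σ)) (Real.exp (-s * F (σ * Equiv.swap i j))) ≤
      4 * s ^ 2 * ∑ σ, max (F σ - F (σ * Equiv.swap i j)) 0 ^ 2 * Real.exp (-s * F σ) := by
  refine (Finset.sum_le_sum fun σ _ => logCross_exp_le hs hs1 (hF σ)).trans (le_of_eq ?_)
  have h := sum_comp_mul_right
    (fun σ => max (F σ - F (σ * Equiv.swap i j)) 0 ^ 2 * Real.exp (-s * F σ)) (Equiv.swap i j)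
  simp only [mul_assoc, Equiv.swap_mul_self, mul_one] at h
  rw [Finset.sum_add_distrib, ← Finset.mul_sum, ← Finset.mul_sum, h]
  ring

lemma entropy_exp_le [Nonempty α] {F : Equiv.Perm α → ℝ}
    (hself : ∀ σ, ∑ i, ∑ j, max (F σ - F (σ * Equiv.swap i j)) 0 ^ 2 ≤
      4 * Fintype.card α * F σ)
    (hF : ∀ i j σ, |F σ - F (σ * Equiv.swap i j)| ≤ 1) {s : ℝ} (hs : 0 < s) (hs1 : s ≤ 1) :
    -s * ∑ σ, F σ * Real.exp (-s * F σ) - (∑ σ, Real.exp (-s * F σ)) *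
        Real.log ((∑ σ, Real.exp (-s * F σ)) / Fintype.card (Equiv.Perm α)) ≤
      8 * s ^ 2 * ∑ σ, F σ * Real.exp (-s * F σ) := by
  have hN : (0 : ℝ) < Fintype.card α := by exact_mod_cast Fintype.card_pos
  have h1 := modified_log_sobolev_perm (fun σ => Real.exp_pos (-s * F σ))
  have h2 : ∑ i, ∑ j, ∑ σ, logCross (Real.exp (-s * F σ))
      (Real.exp (-s * F (σ * Equiv.swap i j))) ≤
      4 * s ^ 2 * ∑ σ, 4 * Fintype.card α * F σ * Real.exp (-s * F σ) := by
    refine (Finset.sum_le_sum fun i _ => Finset.sum_le_sum fun j _ =>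
      sum_logCross_exp_le hs hs1 i j (hF i j)).trans ?_
    simp only [← Finset.mul_sum]
    refine mul_le_mul_of_nonneg_left ?_ (by positivity)
    have hc : ∑ i, ∑ j, ∑ σ, max (F σ - F (σ * Equiv.swap i j)) 0 ^ 2 * Real.exp (-s * F σ) =
        ∑ σ, (∑ i, ∑ j, max (F σ - F (σ * Equiv.swap i j)) 0 ^ 2) * Real.exp (-s * F σ) := by
      simp only [Finset.sum_mul]
      rw [Finset.sum_comm]
      simp only [Finset.sum_comm (s := (Finset.univ : Finset (Equiv.Perm α)))]
      exact Finset.sum_comm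
    rw [hc]
    exact Finset.sum_le_sum fun σ _ => mul_le_mul_of_nonneg_right (hself σ) (Real.exp_pos _).le
  have h3 := h1.trans (div_le_div_of_nonneg_right h2 (by positivity))
  have h4 : ∑ σ, Real.exp (-s * F σ) * Real.log (Real.exp (-s * F σ)) =
      -s * ∑ σ, F σ * Real.exp (-s * F σ) := by
    rw [Finset.mul_sum]
    exact Finset.sum_congr rfl fun σ _ => by rw [Real.log_exp]; ring
  have h5 : 4 * s ^ 2 * (∑ σ, 4 * Fintype.card α * F σ * Real.exp (-s * F σ)) /
      (2 * Fintype.card α) = 8 * s ^ 2 * ∑ σ, F σ * Real.exp (-s * F σ) := by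
    simp only [mul_assoc, ← Finset.mul_sum]
    field_simp
    ring
  rw [h4, h5] at h3
  exact h3

lemma laplace_lower_bound [Nonempty α] {F : Equiv.Perm α → ℝ}
    (hself : ∀ σ, ∑ i, ∑ j, max (F σ - F (σ * Equiv.swap i j)) 0 ^ 2 ≤
      4 * Fintype.card α * F σ)
    (hF : ∀ i j σ, |F σ - F (σ * Equiv.swap i j)| ≤ 1) {s : ℝ} (hs : 0 < s) (hs1 : s ≤ 1) :
    s * ((∑ σ, F σ) / Fintype.card (Equiv.Perm α)) ≤
      -((1 + 8 * s) * Real.log ((∑ σ, Real.exp (-s * F σ)) / Fintype.card (Equiv.Perm α))) := by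
  have hn : (0 : ℝ) < Fintype.card (Equiv.Perm α) := by exact_mod_cast Fintype.card_pos
  have hZ : ∀ r, 0 < ∑ σ, Real.exp (-r * F σ) := fun r =>
    Finset.sum_pos (fun σ _ => Real.exp_pos _) Finset.univ_nonempty
  have hdZ : ∀ r, HasDerivAt (fun r => ∑ σ, Real.exp (-r * F σ))
      (-∑ σ, F σ * Real.exp (-r * F σ)) r := fun r => by
    rw [← Finset.sum_neg_distrib]
    refine HasDerivAt.fun_sum fun σ _ => ?_
    have := (((hasDerivAt_id r).neg).mul_const (F σ)).exp
    refine this.congr_deriv ?_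
    simp [mul_comm]
  have hd : ∀ r, HasDerivAt
      (fun r => -Real.log ((∑ σ, Real.exp (-r * F σ)) / Fintype.card (Equiv.Perm α)))
      ((∑ σ, F σ * Real.exp (-r * F σ)) / ∑ σ, Real.exp (-r * F σ)) r := fun r => by
    refine (((hdZ r).div_const _).log (div_pos (hZ r) hn).ne').neg.congr_deriv ?_
    rw [neg_div, neg_div, neg_neg, div_div_div_cancel_right₀ hn.ne']
  have key := herbst_lower_bound hd (by simp [hn.ne']) (fun r hr hr1 => by
    have h := entropy_exp_le hself hF hr hr1
    rw [← mul_div_assoc, le_div_iff₀ (hZ r)]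
    linarith) hs hs1
  simp only [neg_zero, zero_mul, Real.exp_zero, mul_one, Finset.sum_const, nsmul_eq_mul,
    Finset.card_univ] at key
  linarith

lemma perm_lower_tail [Nonempty α] {F : Equiv.Perm α → ℝ}
    (hself : ∀ σ, ∑ i, ∑ j, max (F σ - F (σ * Equiv.swap i j)) 0 ^ 2 ≤
      4 * Fintype.card α * F σ)
    (hF : ∀ i j σ, |F σ - F (σ * Equiv.swap i j)| ≤ 1) {m t : ℝ}
    (hm : m = (∑ σ, F σ) / Fintype.card (Equiv.Perm α)) (ht : 0 ≤ t) (htm : t ≤ m) :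
    ((Finset.univ.filter fun σ => m - F σ ≥ t).card : ℝ) / Fintype.card (Equiv.Perm α) ≤
      Real.exp (-(t ^ 2) / (32 * m)) := by
  have hn : (0 : ℝ) < Fintype.card (Equiv.Perm α) := by exact_mod_cast Fintype.card_pos
  rcases ht.eq_or_lt with rfl | ht0
  · simp only [ne_eq, OfNat.ofNat_ne_zero, not_false_eq_true, zero_pow, neg_zero, zero_div,
      Real.exp_zero]
    rw [div_le_one hn]
    exact_mod_cast Finset.card_le_univ _
  have hm0 : 0 < m := ht0.trans_le htm
  set s := t / (16 * m) with hsdef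
  have hs : 0 < s := by positivity
  have hs1 : s ≤ 1 := by rw [hsdef, div_le_one (by positivity)]; linarith
  have hst : s * (16 * m) = t := by rw [hsdef]; field_simp
  have hL := laplace_lower_bound hself hF hs hs1
  rw [← hm] at hL
  set Z := ∑ σ, Real.exp (-s * F σ) with hZdef
  have hZ : 0 < Z := Finset.sum_pos (fun σ _ => Real.exp_pos _) Finset.univ_nonempty
  have hlog : Real.log (Z / Fintype.card (Equiv.Perm α)) ≤ -(s * m) + 8 * s ^ 2 * m := by
    have h1 : s * m * (1 - 8 * s) * (1 + 8 * s) ≤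
        -Real.log (Z / Fintype.card (Equiv.Perm α)) * (1 + 8 * s) := by
      have : 0 ≤ s * m * (64 * s ^ 2) := by positivity
      nlinarith
    have h2 := le_of_mul_le_mul_right h1 (by positivity)
    linarith
  have hZle : Z / Fintype.card (Equiv.Perm α) ≤ Real.exp (-(s * m) + 8 * s ^ 2 * m) :=
    (Real.log_le_iff_le_exp (div_pos hZ hn)).1 hlog
  have hcount : ((Finset.univ.filter fun σ => m - F σ ≥ t).card : ℝ) *
      Real.exp (-s * (m - t)) ≤ Z := by
    rw [← nsmul_eq_mul, ← Finset.sum_const]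
    refine (Finset.sum_le_sum fun σ hσ => ?_).trans
      (Finset.sum_le_sum_of_subset_of_nonneg (Finset.filter_subset _ _)
        fun σ _ _ => (Real.exp_pos (-s * F σ)).le)
    rw [Finset.mem_filter] at hσ
    exact Real.exp_le_exp.2 (by nlinarith [hσ.2])
  have hexp : Real.exp (-(t ^ 2) / (32 * m)) =
      Real.exp (-(s * m) + 8 * s ^ 2 * m) * Real.exp (s * (m - t)) := by
    rw [← Real.exp_add, ← hst]
    congr 1
    field_simp
    ring
  rw [hexp]
  refine le_trans ?_ (mul_le_mul_of_nonneg_right hZle (Real.exp_pos _).le)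
  rw [div_mul_eq_mul_div]
  refine div_le_div_of_nonneg_right ?_ hn.le
  have := mul_le_mul_of_nonneg_right hcount (Real.exp_pos (s * (m - t))).le
  rwa [mul_assoc, ← Real.exp_add, neg_mul, neg_add_cancel, Real.exp_zero, mul_one] at this

end LowerTail

section Multislice

lemma sum_sum_eq_two_mul_sum_lt {N : ℕ} (D : Fin N → Fin N → ℝ) (hD : ∀ i j, D i j = D j i) :
    ∑ i, ∑ j, D i j = 2 * ∑ q ∈ (Finset.univ : Finset (Fin N × Fin N)).filter
      (fun q => q.1 < q.2), D q.1 q.2 + ∑ i, D i i := by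
  have hdiag : ∑ i, D i i = ∑ i, ∑ j, if i = j then D i j else 0 := by simp
  have hsymm : ∑ i, ∑ j, (if j < i then D i j else 0) = ∑ i, ∑ j, if i < j then D i j else 0 := by
    rw [Finset.sum_comm]
    simp only [hD]
  rw [Finset.sum_filter, Fintype.sum_prod_type, hdiag, two_mul]
  nth_rw 2 [← hsymm]
  simp only [← Finset.sum_add_distrib]
  refine Finset.sum_congr rfl fun i _ => Finset.sum_congr rfl fun j _ => ?_
  rcases lt_trichotomy i j with h | h | h
  · simp [h, h.ne, h.not_gt]
  · simp [h]
  · simp [h, h.ne', h.not_gt]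

lemma mem_multislice {L N : ℕ} {κ : Fin L → ℕ} {x : Fin L → ℝ} {ω : Fin N → ℝ} :
    ω ∈ multislice L N κ x ↔ (∀ i, ∃ ℓ, x ℓ = ω i) ∧
      ∀ ℓ, (Finset.univ.filter fun i => ω i = x ℓ).card = κ ℓ := by
  simp [multislice, Fintype.mem_piFinset]

lemma card_filter_comp_perm {N : ℕ} (ω : Fin N → ℝ) (σ : Equiv.Perm (Fin N)) (y : ℝ) :
    (Finset.univ.filter fun i => (ω ∘ σ) i = y).card =
      (Finset.univ.filter fun i => ω i = y).card := by
  refine Finset.card_bij (fun i _ => σ i) (by simp) (fun _ _ _ _ h => σ.injective h) ?_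
  intro i hi
  exact ⟨σ.symm i, by simpa using hi, by simp⟩

lemma comp_perm_mem_multislice {L N : ℕ} {κ : Fin L → ℕ} {x : Fin L → ℝ} {ω : Fin N → ℝ}
    (hω : ω ∈ multislice L N κ x) (σ : Equiv.Perm (Fin N)) :
    ω ∘ σ ∈ multislice L N κ x := by
  rw [mem_multislice] at hω ⊢
  exact ⟨fun i => hω.1 (σ i), fun ℓ => (card_filter_comp_perm ω σ (x ℓ)).trans (hω.2 ℓ)⟩

lemma exists_perm_of_mem_multislice {L N : ℕ} {κ : Fin L → ℕ} {x : Fin L → ℝ}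
    {ω ω₀ : Fin N → ℝ} (hω : ω ∈ multislice L N κ x) (hω₀ : ω₀ ∈ multislice L N κ x) :
    ∃ σ : Equiv.Perm (Fin N), ω = ω₀ ∘ σ := by
  rw [mem_multislice] at hω hω₀
  have hcard : ∀ y, Nonempty ({i // ω i = y} ≃ {i // ω₀ i = y}) := fun y => by
    rw [← Fintype.card_eq]
    by_cases hy : ∃ ℓ, x ℓ = y
    · obtain ⟨ℓ, rfl⟩ := hy
      rw [Fintype.card_subtype, Fintype.card_subtype, hω.2, hω₀.2]
    · have h1 : IsEmpty {i // ω i = y} :=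
        ⟨fun i => hy ((hω.1 i).imp fun _ h => h.trans i.2)⟩
      have h2 : IsEmpty {i // ω₀ i = y} :=
        ⟨fun i => hy ((hω₀.1 i).imp fun _ h => h.trans i.2)⟩
      simp
  let e := fun y => (hcard y).some
  refine ⟨(Equiv.sigmaFiberEquiv ω).symm.trans
    ((Equiv.sigmaCongrRight e).trans (Equiv.sigmaFiberEquiv ω₀)), ?_⟩
  funext i
  exact ((e (ω i)) ⟨i, rfl⟩).2.symm

lemma sum_multislice_comp_perm {L N : ℕ} {κ : Fin L → ℕ} {x : Fin L → ℝ}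
    (g : (Fin N → ℝ) → ℝ) (σ : Equiv.Perm (Fin N)) :
    ∑ ω ∈ multislice L N κ x, g (ω ∘ σ) = ∑ ω ∈ multislice L N κ x, g ω := by
  refine Finset.sum_nbij' (fun ω => ω ∘ σ) (fun ω => ω ∘ σ.symm)
    (fun ω hω => comp_perm_mem_multislice hω σ)
    (fun ω hω => comp_perm_mem_multislice hω σ.symm) ?_ ?_ (fun _ _ => rfl)
  · intro ω _; funext i; simp
  · intro ω _; funext i; simp

/-- The uniform distribution on the multislice is the image of the uniform distribution on
permutations. -/
lemma uexpect_multislice {L N : ℕ} {κ : Fin L → ℕ} {x : Fin L → ℝ} {ω₀ : Fin N → ℝ}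
    (hω₀ : ω₀ ∈ multislice L N κ x) (g : (Fin N → ℝ) → ℝ) :
    uexpect (multislice L N κ x) g =
      (∑ σ : Equiv.Perm (Fin N), g (ω₀ ∘ σ)) / Fintype.card (Equiv.Perm (Fin N)) := by
  have hn : (0 : ℝ) < Fintype.card (Equiv.Perm (Fin N)) := by exact_mod_cast Fintype.card_pos
  have hΩ : (0 : ℝ) < (multislice L N κ x).card := by
    exact_mod_cast Finset.card_pos.2 ⟨ω₀, hω₀⟩
  have horbit : ∀ ω ∈ multislice L N κ x, ∑ σ : Equiv.Perm (Fin N), g (ω ∘ σ) =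
      ∑ σ : Equiv.Perm (Fin N), g (ω₀ ∘ σ) := fun ω hω => by
    obtain ⟨τ, rfl⟩ := exists_perm_of_mem_multislice hω hω₀
    exact Equiv.sum_comp (Equiv.mulLeft τ) fun σ : Equiv.Perm (Fin N) => g (ω₀ ∘ σ)
  have h1 := Finset.sum_congr rfl horbit
  rw [Finset.sum_comm] at h1
  simp only [sum_multislice_comp_perm, Finset.sum_const, nsmul_eq_mul, Finset.card_univ] at h1
  unfold uexpect
  rw [div_eq_div_iff hΩ.ne' hn.ne']
  linarith

lemma uprob_eq_uexpect {β : Type*} (Ω : Finset β) (p : β → Prop) :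
    uprob Ω p = uexpect Ω (fun ω => if p ω then 1 else 0) := by
  simp [uprob, uexpect, Finset.sum_boole]

lemma uprob_multislice {L N : ℕ} {κ : Fin L → ℕ} {x : Fin L → ℝ} {ω₀ : Fin N → ℝ}
    (hω₀ : ω₀ ∈ multislice L N κ x) (p : (Fin N → ℝ) → Prop) :
    uprob (multislice L N κ x) p =
      ((Finset.univ.filter fun σ : Equiv.Perm (Fin N) => p (ω₀ ∘ σ)).card : ℝ) /
        Fintype.card (Equiv.Perm (Fin N)) := by
  rw [uprob_eq_uexpect, uexpect_multislice hω₀, Finset.sum_boole]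

lemma uprob_mono {β : Type*} (Ω : Finset β) {p q : β → Prop} (h : ∀ ω ∈ Ω, p ω → q ω) :
    uprob Ω p ≤ uprob Ω q := by
  refine div_le_div_of_nonneg_right ?_ (Nat.cast_nonneg _)
  exact_mod_cast Finset.card_le_card fun ω hω => by
    rw [Finset.mem_filter] at hω ⊢
    exact ⟨hω.1, h ω hω.1 hω.2⟩

lemma multislice_lower_tail {L N : ℕ} (hN : 0 < N) {κ : Fin L → ℕ} {x : Fin L → ℝ}
    {f : (Fin N → ℝ) → ℝ}
    (hself : ∀ ω ∈ multislice L N κ x, gammaPlusSq f ω ≤ f ω)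
    (hf : ∀ ω ∈ multislice L N κ x, ∀ i j : Fin N, i < j →
      |f ω - f (ω ∘ Equiv.swap i j)| ≤ 1)
    {t : ℝ} (ht : 0 ≤ t) (htm : t ≤ uexpect (multislice L N κ x) f) :
    uprob (multislice L N κ x) (fun ω => uexpect (multislice L N κ x) f - f ω ≥ t) ≤
      Real.exp (-(t ^ 2) / (32 * uexpect (multislice L N κ x) f)) := by
  rcases (multislice L N κ x).eq_empty_or_nonempty with h | ⟨ω₀, hω₀⟩
  · rw [h]
    simp only [uprob, Finset.filter_empty, Finset.card_empty, Nat.cast_zero, zero_div]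
    exact (Real.exp_pos _).le
  have hNR : (0 : ℝ) < N := by exact_mod_cast hN
  have : Nonempty (Fin N) := ⟨⟨0, hN⟩⟩
  rw [uprob_multislice hω₀]
  refine perm_lower_tail (F := fun σ => f (ω₀ ∘ σ)) (fun σ => ?_) (fun i j σ => ?_)
    (uexpect_multislice hω₀ f) ht htm
  · have h := hself _ (comp_perm_mem_multislice hω₀ σ)
    change ∑ i, ∑ j, max (f (ω₀ ∘ σ) - f ((ω₀ ∘ σ) ∘ Equiv.swap i j)) 0 ^ 2 ≤ _
    rw [sum_sum_eq_two_mul_sum_lt (fun i j : Fin N =>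
      max (f (ω₀ ∘ σ) - f ((ω₀ ∘ σ) ∘ Equiv.swap i j)) 0 ^ 2)
      (fun i j => by rw [Equiv.swap_comm])]
    unfold gammaPlusSq at h
    rw [one_div, inv_mul_le_iff₀ (by positivity)] at h
    simp only [Equiv.swap_self, Equiv.coe_refl, Function.comp_id, sub_self, max_self, ne_eq,
      OfNat.ofNat_ne_zero, not_false_eq_true, zero_pow, Finset.sum_const_zero, add_zero,
      Fintype.card_fin]
    linarith
  · have hσ := comp_perm_mem_multislice hω₀ σ
    rcases lt_trichotomy i j with h | h | h
    · exact hf _ hσ i j h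
    · have : σ * Equiv.refl (Fin N) = σ := mul_one σ
      simp [h, this]
    · rw [Equiv.swap_comm]
      exact hf _ hσ j i h

end Multislice

section ConvexDistance

lemma sum_abs_mul_ite_le {m : ℕ} {a : Fin m → ℝ} (ha : ∑ i, a i ^ 2 = 1) (ω ω' : Fin m → ℝ) :
    ∑ i, |a i| * (if ω i = ω' i then (0 : ℝ) else 1) ≤ m := by
  refine (Finset.sum_le_card_nsmul _ _ 1 fun i _ => ?_).trans (by simp)
  have h1 : a i ^ 2 ≤ 1 := ha ▸ Finset.single_le_sum (f := fun i => a i ^ 2)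
    (fun _ _ => sq_nonneg _) (Finset.mem_univ i)
  have h2 : |a i| ≤ 1 := (sq_le_one_iff_abs_le_one _).1 h1
  split_ifs <;> simp [h2]

lemma bddBelow_weighted_mismatch {m : ℕ} (a ω : Fin m → ℝ) (A : Set (Fin m → ℝ)) :
    BddBelow { s : ℝ | ∃ ω' ∈ A,
      s = ∑ i, |a i| * (if ω i = ω' i then (0 : ℝ) else 1) } := by
  refine ⟨0, ?_⟩
  rintro s ⟨ω', _, rfl⟩
  exact Finset.sum_nonneg fun i _ => mul_nonneg (abs_nonneg _) (by split_ifs <;> norm_num)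

lemma convexDist_nonneg {m : ℕ} (ω : Fin m → ℝ) (A : Set (Fin m → ℝ)) :
    0 ≤ convexDist ω A := by
  refine Real.sSup_nonneg ?_
  rintro r ⟨a, _, rfl⟩
  refine Real.sInf_nonneg ?_
  rintro s ⟨ω', _, rfl⟩
  exact Finset.sum_nonneg fun i _ => mul_nonneg (abs_nonneg _) (by split_ifs <;> norm_num)

lemma convexDist_empty {m : ℕ} (ω : Fin m → ℝ) : convexDist ω ∅ = 0 := by
  refine le_antisymm (Real.sSup_le ?_ le_rfl) (convexDist_nonneg ω ∅)
  rintro r ⟨a, _, rfl⟩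
  simp

lemma le_convexDist_mul_sqrt {m : ℕ} {ω : Fin m → ℝ} {A : Set (Fin m → ℝ)} (hA : A.Nonempty)
    {v : Fin m → ℝ} (hv : ∀ i, 0 ≤ v i) {c : ℝ}
    (hc : ∀ ω' ∈ A, c ≤ ∑ i, v i * (if ω i = ω' i then (0 : ℝ) else 1)) :
    c ≤ convexDist ω A * √(∑ i, v i ^ 2) := by
  obtain ⟨ω₁, hω₁⟩ := hA
  have hnn : 0 ≤ ∑ i, v i ^ 2 := Finset.sum_nonneg fun i _ => sq_nonneg _
  rcases hnn.eq_or_lt with h0 | hpos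
  · rw [← h0, Real.sqrt_zero, mul_zero]
    have hz : ∀ i, v i = 0 := fun i => by
      have := (Finset.sum_eq_zero_iff_of_nonneg fun i _ => sq_nonneg (v i)).1 h0.symm i
        (Finset.mem_univ i)
      exact pow_eq_zero_iff two_ne_zero |>.1 this
    simpa [hz] using hc ω₁ hω₁
  set n := √(∑ i, v i ^ 2) with hn
  have hnpos : 0 < n := Real.sqrt_pos.2 hpos
  have hnsq : n ^ 2 = ∑ i, v i ^ 2 := Real.sq_sqrt hnn
  rw [← div_le_iff₀ hnpos]
  have hbdd : BddAbove { r : ℝ | ∃ a : Fin m → ℝ, (∑ i, a i ^ 2) = 1 ∧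
      r = sInf { s : ℝ | ∃ ω' ∈ A, s = ∑ i, |a i| * (if ω i = ω' i then (0 : ℝ) else 1) } } := by
    refine ⟨m, ?_⟩
    rintro r ⟨a, ha, rfl⟩
    exact (csInf_le (bddBelow_weighted_mismatch a ω A) ⟨ω₁, hω₁, rfl⟩).trans
      (sum_abs_mul_ite_le ha ω ω₁)
  have hunit : ∑ i, (v i / n) ^ 2 = 1 := by
    simp only [div_pow]
    rw [← Finset.sum_div, ← hnsq, div_self (by positivity)]
  refine le_trans ?_ (le_csSup hbdd ⟨fun i => v i / n, hunit, rfl⟩)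
  refine le_csInf ⟨_, ω₁, hω₁, rfl⟩ ?_
  rintro s ⟨ω', hω', rfl⟩
  rw [div_le_iff₀ hnpos, Finset.sum_mul]
  refine (hc ω' hω').trans (le_of_eq (Finset.sum_congr rfl fun i _ => ?_))
  rw [abs_of_nonneg (div_nonneg (hv i) hnpos.le)]
  field_simp

/-- The convex distance is the norm of the shortest vector `v` in the convex hull of the mismatch
vectors, and `v` yields the optimal weights. -/
lemma exists_convexDist_optimizer {m : ℕ} (ω : Fin m → ℝ) {A : Set (Fin m → ℝ)}
    (hfin : A.Finite) (hA : A.Nonempty) :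
    ∃ v : Fin m → ℝ, (∀ i, 0 ≤ v i ∧ v i ≤ 1) ∧ ∑ i, v i ^ 2 = convexDist ω A ^ 2 ∧
      ∀ ω' ∈ A, convexDist ω A ^ 2 ≤ ∑ i, v i * (if ω i = ω' i then (0 : ℝ) else 1) := by
  let M : (Fin m → ℝ) → EuclideanSpace ℝ (Fin m) :=
    fun ω' => WithLp.toLp 2 fun i => if ω i = ω' i then (0 : ℝ) else 1
  set K := convexHull ℝ (M '' A) with hK
  have hMK : ∀ ω' ∈ A, M ω' ∈ K := fun ω' h => subset_convexHull ℝ _ ⟨ω', h, rfl⟩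
  have hconv : Convex ℝ K := convex_convexHull ℝ _
  obtain ⟨v, hvK, hvmin⟩ := exists_norm_eq_iInf_of_complete_convex
    ((hA.image M).mono (subset_convexHull ℝ _))
    ((hfin.image M).isCompact_convexHull (𝕜 := ℝ)).isComplete hconv 0
  rw [norm_eq_iInf_iff_real_inner_le_zero hconv hvK] at hvmin
  have hmin : ∀ ω' ∈ A, ∑ i, v i ^ 2 ≤ ∑ i, v i * (if ω i = ω' i then (0 : ℝ) else 1) := by
    intro ω' hω'
    have h := hvmin _ (hMK ω' hω')
    simp only [zero_sub, inner_neg_left, inner_sub_right, PiLp.inner_apply, RCLike.inner_apply,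
      conj_trivial, M] at h
    have h1 : ∑ i, v i ^ 2 = ∑ i, v i * v i := Finset.sum_congr rfl fun i _ => sq _
    have h2 : ∑ i, v i * (if ω i = ω' i then (0 : ℝ) else 1) =
        ∑ i, (if ω i = ω' i then (0 : ℝ) else 1) * v i :=
      Finset.sum_congr rfl fun i _ => mul_comm _ _
    linarith
  have hhull : ∀ (ℓ : Fin m → ℝ) (c : ℝ),
      (∀ ω' ∈ A, c ≤ ∑ i, ℓ i * (if ω i = ω' i then (0 : ℝ) else 1)) →
      c ≤ ∑ i, ℓ i * v i := by
    intro ℓ c h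
    have hlin : IsLinearMap ℝ (fun w : EuclideanSpace ℝ (Fin m) => ∑ i, ℓ i * w i) :=
      ⟨fun a b => by simp [mul_add, Finset.sum_add_distrib], fun r a => by
        simp only [PiLp.smul_apply, smul_eq_mul, Finset.mul_sum]
        exact Finset.sum_congr rfl fun i _ => by ring⟩
    refine convexHull_min ?_ (convex_halfSpace_ge hlin c) hvK
    rintro _ ⟨ω', hω', rfl⟩
    exact h ω' hω'
  have hv0 : ∀ i, 0 ≤ v i := fun i => by
    have := hhull (Pi.single i 1) 0 fun ω' _ => Finset.sum_nonneg fun j _ => by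
      simp only [Pi.single_apply]
      split_ifs <;> norm_num
    simpa [Pi.single_apply] using this
  have hv1 : ∀ i, v i ≤ 1 := fun i => by
    have := hhull (Pi.single i (-1)) (-1) fun ω' _ => by
      simp only [Pi.single_apply, ite_mul, zero_mul, Finset.sum_ite_eq', Finset.mem_univ, if_true]
      split_ifs <;> norm_num
    simp only [Pi.single_apply, ite_mul, zero_mul, Finset.sum_ite_eq', Finset.mem_univ,
      if_true] at this
    linarith
  have hnn : 0 ≤ ∑ i, v i ^ 2 := Finset.sum_nonneg fun i _ => sq_nonneg _
  have hge : √(∑ i, v i ^ 2) ≤ convexDist ω A := by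
    have h := le_convexDist_mul_sqrt hA hv0 hmin
    rcases (Real.sqrt_nonneg (∑ i, v i ^ 2)).eq_or_lt with h0 | hpos
    · rw [← h0]; exact convexDist_nonneg ω A
    · nth_rw 1 [← Real.mul_self_sqrt hnn] at h
      exact le_of_mul_le_mul_right h hpos
  have hle : convexDist ω A ≤ √(∑ i, v i ^ 2) := by
    refine Real.sSup_le ?_ (Real.sqrt_nonneg _)
    rintro r ⟨a, ha, rfl⟩
    have h1 := hhull (fun i => |a i|) _ fun ω' hω' =>
      csInf_le (bddBelow_weighted_mismatch a ω A) ⟨ω', hω', rfl⟩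
    refine h1.trans ((Real.sum_mul_le_sqrt_mul_sqrt _ _ _).trans ?_)
    simp [ha]
  have hsq : ∑ i, v i ^ 2 = convexDist ω A ^ 2 := by
    rw [le_antisymm hle hge, Real.sq_sqrt hnn]
  exact ⟨v, fun i => ⟨hv0 i, hv1 i⟩, hsq, hsq ▸ hmin⟩

lemma sum_mismatch_le_swap {m : ℕ} {v : Fin m → ℝ} (hv : ∀ i, 0 ≤ v i) (ω ω' : Fin m → ℝ)
    {i j : Fin m} (hij : i ≠ j) :
    ∑ k, v k * (if ω k = ω' k then (0 : ℝ) else 1) - (v i + v j) ≤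
      ∑ k, v k * (if (ω ∘ Equiv.swap i j) k = ω' k then (0 : ℝ) else 1) := by
  have h : v i + v j = ∑ k, if k = i ∨ k = j then v k else 0 := by
    rw [← Finset.sum_filter, Finset.filter_or, Finset.filter_eq', Finset.filter_eq']
    simp only [Finset.mem_univ, if_true]
    rw [← Finset.insert_eq, Finset.sum_pair hij]
  rw [h, ← Finset.sum_sub_distrib]
  refine Finset.sum_le_sum fun k _ => ?_
  have hk := hv k
  by_cases hki : k = i ∨ k = j
  · rw [if_pos hki]
    split_ifs <;> linarith
  · rw [if_neg hki]
    push Not at hki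
    simp [Equiv.swap_apply_of_ne_of_ne hki.1 hki.2]

lemma exists_weights_convexDist_sq_sub_le {m : ℕ} (ω : Fin m → ℝ) {A : Set (Fin m → ℝ)}
    (hfin : A.Finite) :
    ∃ v : Fin m → ℝ, (∀ i, 0 ≤ v i ∧ v i ≤ 1) ∧ ∑ i, v i ^ 2 = convexDist ω A ^ 2 ∧
      ∀ i j, i ≠ j → convexDist ω A ^ 2 - convexDist (ω ∘ Equiv.swap i j) A ^ 2 ≤
        2 * (v i + v j) := by
  rcases A.eq_empty_or_nonempty with rfl | hA
  · exact ⟨0, by simp, by simp [convexDist_empty], by simp [convexDist_empty]⟩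
  obtain ⟨v, hv, hsq, hmin⟩ := exists_convexDist_optimizer ω hfin hA
  refine ⟨v, hv, hsq, fun i j hij => ?_⟩
  have h := le_convexDist_mul_sqrt (ω := ω ∘ Equiv.swap i j) hA (fun i => (hv i).1)
    (c := convexDist ω A ^ 2 - (v i + v j)) fun ω' hω' =>
      (sub_le_sub_right (hmin ω' hω') _).trans
        (sum_mismatch_le_swap (fun i => (hv i).1) ω ω' hij)
  rw [hsq, Real.sqrt_sq (convexDist_nonneg ω A)] at h
  nlinarith [sq_nonneg (convexDist ω A - convexDist (ω ∘ Equiv.swap i j) A)]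

lemma gammaPlusSq_convexDist_le {N : ℕ} (hN : 0 < N) (ω : Fin N → ℝ) {A : Set (Fin N → ℝ)}
    (hfin : A.Finite) :
    gammaPlusSq (fun ω' => (1 / 4) * convexDist ω' A ^ 2) ω ≤ (1 / 4) * convexDist ω A ^ 2 := by
  obtain ⟨v, hv, hsq, hle⟩ := exists_weights_convexDist_sq_sub_le ω hfin
  have hNR : (0 : ℝ) < N := by exact_mod_cast hN
  have hterm : ∀ q ∈ (Finset.univ : Finset (Fin N × Fin N)).filter (fun q => q.1 < q.2),
      max ((1 / 4) * convexDist ω A ^ 2 -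
        (1 / 4) * convexDist (ω ∘ Equiv.swap q.1 q.2) A ^ 2) 0 ^ 2 ≤
      (1 / 2) * (v q.1 ^ 2 + v q.2 ^ 2) := by
    intro q hq
    rw [Finset.mem_filter] at hq
    have h1 := hle q.1 q.2 hq.2.ne
    have h2 : max ((1 / 4) * convexDist ω A ^ 2 -
        (1 / 4) * convexDist (ω ∘ Equiv.swap q.1 q.2) A ^ 2) 0 ≤ (1 / 2) * (v q.1 + v q.2) :=
      max_le (by linarith) (by linarith [(hv q.1).1, (hv q.2).1])
    have h3 := pow_le_pow_left₀ (le_max_right _ _) h2 2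
    nlinarith [sq_nonneg (v q.1 - v q.2)]
  have hpairs := sum_sum_eq_two_mul_sum_lt (fun i j => (1 / 2) * (v i ^ 2 + v j ^ 2))
    fun i j => by ring
  have hdiag : 0 ≤ ∑ i, (1 / 2) * (v i ^ 2 + v i ^ 2) :=
    Finset.sum_nonneg fun i _ => by positivity
  have hall : ∑ i, ∑ j, (1 / 2) * (v i ^ 2 + v j ^ 2) = N * convexDist ω A ^ 2 := by
    simp only [← Finset.mul_sum, Finset.sum_add_distrib, Finset.sum_const, Finset.card_univ,
      Fintype.card_fin, nsmul_eq_mul, hsq]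
    ring
  unfold gammaPlusSq
  rw [one_div, inv_mul_le_iff₀ (by positivity)]
  refine (Finset.sum_le_sum hterm).trans ?_
  linarith

lemma abs_convexDist_sq_sub_le {N : ℕ} (ω : Fin N → ℝ) {A : Set (Fin N → ℝ)}
    (hfin : A.Finite) {i j : Fin N} (hij : i ≠ j) :
    |(1 / 4) * convexDist ω A ^ 2 - (1 / 4) * convexDist (ω ∘ Equiv.swap i j) A ^ 2| ≤ 1 := by
  have key : ∀ ω : Fin N → ℝ,
      convexDist ω A ^ 2 - convexDist (ω ∘ Equiv.swap i j) A ^ 2 ≤ 4 := fun ω => by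
    obtain ⟨v, hv, -, hle⟩ := exists_weights_convexDist_sq_sub_le ω hfin
    linarith [hle i j hij, (hv i).2, (hv j).2]
  have h1 := key ω
  have h2 := key (ω ∘ Equiv.swap i j)
  have hinv : (ω ∘ Equiv.swap i j) ∘ Equiv.swap i j = ω := by
    funext k; simp
  rw [hinv] at h2
  rw [abs_le]
  constructor <;> linarith

end ConvexDistance

/-- Lower-tail estimate for nonnegative self-bounding-type functions on the multislice,
and the fact that `(1/4) d_T(·, A)²` satisfies the hypotheses for every `A ⊆ Ω_κ`. -/
theorem stmt19 (L N : ℕ) (hL : 2 ≤ L) (κ : Fin L → ℕ) (hκ : ∀ ℓ, 1 ≤ κ ℓ)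
    (hN : N = ∑ ℓ, κ ℓ) (x : Fin L → ℝ) (hx : StrictMono x) :
    (∀ f : (Fin N → ℝ) → ℝ,
      (∀ ω ∈ multislice L N κ x, 0 ≤ f ω) →
      (∀ ω ∈ multislice L N κ x, gammaPlusSq f ω ≤ f ω) →
      (∀ ω ∈ multislice L N κ x, ∀ i j : Fin N, i < j →
        |f ω - f (ω ∘ Equiv.swap i j)| ≤ 1) →
      (∀ t : ℝ, 0 ≤ t → t ≤ uexpect (multislice L N κ x) f →
        uprob (multislice L N κ x) (fun ω => uexpect (multislice L N κ x) f - f ω ≥ t) ≤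
          Real.exp (-(t ^ 2) / (32 * uexpect (multislice L N κ x) f))) ∧
      uprob (multislice L N κ x) (fun ω => f ω = 0) *
        Real.exp (uexpect (multislice L N κ x) f / 32) ≤ 1) ∧
    (∀ A : Set (Fin N → ℝ), A ⊆ ↑(multislice L N κ x) →
      (∀ ω ∈ multislice L N κ x,
        gammaPlusSq (fun ω' => (1 / 4) * convexDist ω' A ^ 2) ω ≤
          (1 / 4) * convexDist ω A ^ 2) ∧
      (∀ ω ∈ multislice L N κ x, ∀ i j : Fin N, i < j →
        |(1 / 4) * convexDist ω A ^ 2 -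
          (1 / 4) * convexDist (ω ∘ Equiv.swap i j) A ^ 2| ≤ 1)) := by
  have hNpos : 0 < N := by
    have h0 : κ ⟨0, by omega⟩ ≤ ∑ ℓ, κ ℓ :=
      Finset.single_le_sum (fun _ _ => Nat.zero_le _) (Finset.mem_univ _)
    have := hκ ⟨0, by omega⟩
    omega
  refine ⟨fun f hf0 hself hf => ?_, fun A hA => ?_⟩
  · have htail := fun t ht htm => multislice_lower_tail hNpos hself hf (t := t) ht htm
    refine ⟨htail, ?_⟩
    have hm : 0 ≤ uexpect (multislice L N κ x) f :=
      div_nonneg (Finset.sum_nonneg hf0) (Nat.cast_nonneg _)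
    have h1 := htail _ hm le_rfl
    have h2 : uprob (multislice L N κ x) (fun ω => f ω = 0) ≤
        Real.exp (-(uexpect (multislice L N κ x) f / 32)) := by
      refine (uprob_mono _ fun ω _ h => ?_).trans (h1.trans (le_of_eq ?_))
      · simp [h]
      · congr 1
        rcases hm.eq_or_lt with h0 | hpos
        · simp [← h0]
        · field_simp
    refine (mul_le_mul_of_nonneg_right h2 (Real.exp_pos _).le).trans (le_of_eq ?_)
    rw [← Real.exp_add, neg_add_cancel, Real.exp_zero]
  · have hfin : A.Finite := (multislice L N κ x).finite_toSet.subset hA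
    exact ⟨fun ω _ => gammaPlusSq_convexDist_le hNpos ω hfin,
      fun ω _ i j hij => abs_convexDist_sq_sub_le ω hfin hij.ne⟩
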